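/- Let G = (V,E) be an oriented graph and k, ℓ positive integers. Then t_G(1+ℓ, 1+k) equals the number of triples (f,t,σ) where f is a Z_k-flow on G, t is a Z_ℓ-tension on G, supp(f) ∩ supp(t) = ∅, and σ ⊆ E \ (supp(f) ∪ supp(t)). -/

import Mathlib

namespace ModularFlows

attribute [local instance] Classical.propDecidable

variable {V E : Type}

/-- A directed (simple) cycle, given by its cyclically ordered edges
`c 0, c 1, …, c n`: consecutive edges are head-to-tail compatible (also from
`c n` back to `c 0`) and the start vertices are pairwise distinct. -/
def IsDirCycle (src tgt : E → V) (n : ℕ) (c : Fin (n + 1) → E) : Prop :=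
  Function.Injective (fun i => src (c i)) ∧ ∀ i, tgt (c i) = src (c (i + 1))

/-- An oriented graph is totally cyclic if every edge lies on a directed cycle. -/
def TotallyCyclic (src tgt : E → V) : Prop :=
  ∀ e : E, ∃ (n : ℕ) (c : Fin (n + 1) → E), IsDirCycle src tgt n c ∧ e ∈ Set.range c

/-- An oriented graph is acyclic if it contains no directed cycle. -/
def Acyclic (src tgt : E → V) : Prop :=
  ∀ (n : ℕ) (c : Fin (n + 1) → E), ¬ IsDirCycle src tgt n c

/-- Source map of the reorientation of the graph along `σ`. -/
noncomputable def rsrc (src tgt : E → V) (σ : Set E) (e : E) : V :=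
  if e ∈ σ then tgt e else src e

/-- Target map of the reorientation of the graph along `σ`. -/
noncomputable def rtgt (src tgt : E → V) (σ : Set E) (e : E) : V :=
  if e ∈ σ then src e else tgt e

/-- A `ZMod k`-flow: conservation of flow at every vertex. -/
def IsFlow [Fintype E] (src tgt : E → V) (k : ℕ) (f : E → ZMod k) : Prop :=
  ∀ v : V, (∑ e : E, if tgt e = v then f e else 0) = ∑ e : E, if src e = v then f e else 0

/-- Start vertex of an edge traversed forwards (`true`) or backwards (`false`). -/
def uSrc (src tgt : E → V) (p : E × Bool) : V := if p.2 then src p.1 else tgt p.1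

/-- End vertex of an edge traversed forwards (`true`) or backwards (`false`). -/
def uTgt (src tgt : E → V) (p : E × Bool) : V := if p.2 then tgt p.1 else src p.1

/-- A cycle of the underlying undirected graph, with a chosen traversal
direction: a cyclic sequence of edges, each traversed forwards or backwards,
consecutive ones compatible, visiting pairwise distinct vertices. -/
def IsUCycle (src tgt : E → V) (n : ℕ) (c : Fin (n + 1) → E × Bool) : Prop :=
  Function.Injective (fun i => uSrc src tgt (c i)) ∧
    ∀ i, uTgt src tgt (c i) = uSrc src tgt (c (i + 1))

/-- A `ZMod l`-tension: the signed sum over every cycle of the underlying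
undirected graph (forward edges positively, backward edges negatively) vanishes. -/
def IsTension (src tgt : E → V) (l : ℕ) (t : E → ZMod l) : Prop :=
  ∀ (n : ℕ) (c : Fin (n + 1) → E × Bool), IsUCycle src tgt n c →
    (∑ i : Fin (n + 1), if (c i).2 then t (c i).1 else - t (c i).1) = 0

/-- Adjacency via an edge of `S` (its equivalence closure gives the components
of the spanning subgraph `(V, S)`). -/
def linkRel (src tgt : E → V) (S : Set E) (u v : V) : Prop :=
  ∃ e ∈ S, src e = u ∧ tgt e = v

/-- Number of (weakly) connected components of the spanning subgraph `(V, S)`. -/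
noncomputable def ncompSub (src tgt : E → V) (S : Set E) : ℕ :=
  Nat.card (Quot (linkRel src tgt S))

/-- Number of (weakly) connected components. -/
noncomputable def ncomp (src tgt : E → V) : ℕ :=
  ncompSub src tgt Set.univ

/-- The cyclotomic number `ξ(G) = |E| - |V| + c(G)`. -/
noncomputable def xi [Fintype V] [Fintype E] (src tgt : E → V) : ℤ :=
  (Fintype.card E : ℤ) - (Fintype.card V : ℤ) + (ncomp src tgt : ℤ)

/-- Source map of the contraction `G/S`: vertices are identified along edges of
`S`, and the edges of `S` are removed. -/
def csrc (src tgt : E → V) (S : Set E) (e : {e : E // e ∉ S}) :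
    Quot (linkRel src tgt S) :=
  Quot.mk _ (src e.1)

/-- Target map of the contraction `G/S`. -/
def ctgt (src tgt : E → V) (S : Set E) (e : {e : E // e ∉ S}) :
    Quot (linkRel src tgt S) :=
  Quot.mk _ (tgt e.1)

/-- Source (or target) map of the deletion `G∖S`. -/
def dsrc (src : E → V) (S : Set E) (e : {e : E // e ∉ S}) : V := src e.1

/-- Source (or target) map of the restriction `G[S]`. -/
def ressrc (src : E → V) (S : Set E) (e : {e : E // e ∈ S}) : V := src e.1

/-- `σ` is a totally cyclic reorientation of the contraction `G/S`. -/
def TCReorContr (src tgt : E → V) (S σ : Set E) : Prop :=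
  TotallyCyclic (rsrc (csrc src tgt S) (ctgt src tgt S) {e | e.1 ∈ σ})
                (rtgt (csrc src tgt S) (ctgt src tgt S) {e | e.1 ∈ σ})

/-- `σ` is a totally cyclic reorientation of the deletion `G∖S`. -/
def TCReorDel (src tgt : E → V) (S σ : Set E) : Prop :=
  TotallyCyclic (rsrc (dsrc src S) (dsrc tgt S) {e | e.1 ∈ σ})
                (rtgt (dsrc src S) (dsrc tgt S) {e | e.1 ∈ σ})

/-- `σ` is an acyclic reorientation of the deletion `G∖S`. -/
def AcyclicReorDel (src tgt : E → V) (S σ : Set E) : Prop :=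
  Acyclic (rsrc (dsrc src S) (dsrc tgt S) {e | e.1 ∈ σ})
          (rtgt (dsrc src S) (dsrc tgt S) {e | e.1 ∈ σ})

/-- Entry of the incidence matrix `A_G` at vertex `v` and edge `e`. -/
noncomputable def inc (src tgt : E → V) (v : V) (e : E) : ℤ :=
  (if tgt e = v then 1 else 0) - (if src e = v then 1 else 0)

/-- The number of nowhere-zero `ZMod k`-flows. -/
noncomputable def nzFlowCount [Fintype E] (src tgt : E → V) (k : ℕ) : ℕ :=
  Nat.card {f : E → ZMod k // IsFlow src tgt k f ∧ ∀ e, f e ≠ 0}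

/-- The number of nowhere-zero `ZMod l`-tensions. -/
noncomputable def nzTensionCount (src tgt : E → V) (l : ℕ) : ℕ :=
  Nat.card {t : E → ZMod l // IsTension src tgt l t ∧ ∀ e, t e ≠ 0}

/-- The rank `r(S) = |V| - c(V,S)` of an edge set `S`. -/
noncomputable def rk [Fintype V] (src tgt : E → V) (S : Set E) : ℕ :=
  Fintype.card V - ncompSub src tgt S

/-- The Tutte polynomial `t_G(x,y) = Σ_{S ⊆ E} (x-1)^{r(E)-r(S)} (y-1)^{|S|-r(S)}`. -/
noncomputable def tutte [Fintype V] [Fintype E] (src tgt : E → V) (x y : ℚ) : ℚ :=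
  ∑ S : Finset E,
    (x - 1) ^ (rk src tgt Set.univ - rk src tgt ↑S) * (y - 1) ^ (S.card - rk src tgt ↑S)

/-- `e` is a coloop (bridge): deleting it increases the number of components. -/
def IsColoop (src tgt : E → V) (e : E) : Prop :=
  ncompSub src tgt ({e} : Set E)ᶜ = ncomp src tgt + 1

/-- The number of pairs `(f, σ)` of a `ZMod k`-flow `f` and a totally cyclic
reorientation `σ ⊆ E ∖ supp f` of the contraction `G/supp f`. -/
noncomputable def phiR [Fintype E] (src tgt : E → V) (k : ℕ) : ℕ :=
  Nat.card {p : (E → ZMod k) × Set E //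
    IsFlow src tgt k p.1 ∧ p.2 ⊆ {e | p.1 e = 0} ∧
    TCReorContr src tgt {e | p.1 e ≠ 0} p.2}

/-- The in-degree sequence of the reorientation of the graph along `σ`. -/
noncomputable def indegSeq [Fintype E] (src tgt : E → V) (σ : Set E) (v : V) : ℤ :=
  (Nat.card {e : E // rtgt src tgt σ e = v} : ℤ)

/-- The vector `A_G · e_σ`, where `e_σ` is the characteristic vector of `σ`. -/
noncomputable def AeVec [Fintype E] (src tgt : E → V) (σ : Set E) (v : V) : ℤ :=
  ∑ e : E, if e ∈ σ then inc src tgt v e else 0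

/-- `τ'` is obtained from `τ` by reversing a directed cycle of `_τG`. -/
def cycleReverse (src tgt : E → V) (τ τ' : Set E) : Prop :=
  ∃ (n : ℕ) (c : Fin (n + 1) → E),
    IsDirCycle (rsrc src tgt τ) (rtgt src tgt τ) n c ∧ τ' = symmDiff τ (Set.range c)

/-- The functions on the vertices that are constant along every edge of `S`. -/
def edgeConstant (src tgt : E → V) (S : Set E) (A : Type) [AddCommGroup A] :
    AddSubgroup (V → A) where
  carrier := {p | ∀ e ∈ S, p (src e) = p (tgt e)}
  zero_mem' := fun _ _ => rfl
  add_mem' := fun hp hq e he => by simp [hp e he, hq e he]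
  neg_mem' := fun hp e he => by simp [hp e he]

/-- The difference map sending a potential on the vertices to a function on the edges. -/
def coboundary (src tgt : E → V) (A : Type) [AddCommGroup A] : (V → A) →+ (E → A) where
  toFun p e := p (tgt e) - p (src e)
  map_zero' := by ext; simp
  map_add' p q := by ext; simp only [Pi.add_apply]; abel

theorem coboundary_apply (src tgt : E → V) (A : Type) [AddCommGroup A] (p : V → A) (e : E) :
    coboundary src tgt A p e = p (tgt e) - p (src e) := rfl

/-- Functions constant along the edges of `S` are functions on the components of `(V, S)`. -/
def edgeConstantEquiv (src tgt : E → V) (S : Set E) (A : Type) [AddCommGroup A] :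
    edgeConstant src tgt S A ≃ (Quot (linkRel src tgt S) → A) where
  toFun p := Quot.lift p.1 (by rintro _ _ ⟨e, he, rfl, rfl⟩; exact p.2 e he)
  invFun q := ⟨fun v => q (Quot.mk _ v), fun e he => congrArg q (Quot.sound ⟨e, he, rfl, rfl⟩)⟩
  left_inv _ := rfl
  right_inv q := by ext x; induction x using Quot.ind; rfl

theorem card_edgeConstant [Finite V] (src tgt : E → V) (S : Set E) (m : ℕ) :
    Nat.card (edgeConstant src tgt S (ZMod m)) = m ^ ncompSub src tgt S := by
  rw [Nat.card_congr (edgeConstantEquiv src tgt S (ZMod m)), Nat.card_fun, Nat.card_zmod]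
  rfl

theorem ncompSub_le_card [Fintype V] (src tgt : E → V) (S : Set E) :
    ncompSub src tgt S ≤ Fintype.card V := by
  rw [← Nat.card_eq_fintype_card]
  exact Nat.card_le_card_of_surjective _ (Quot.mk_surjective (r := linkRel src tgt S))

theorem eq_pow_sub_of_mul_pow_eq_pow {N m a b : ℕ} (hm : 0 < m) (h : N * m ^ a = m ^ b) :
    N = m ^ (b - a) := by
  have hpos : 0 < m ^ a := Nat.pow_pos hm
  rcases le_or_gt a b with hab | hab
  · refine Nat.eq_of_mul_eq_mul_right hpos ?_
    rw [h, ← pow_add, Nat.sub_add_cancel hab]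
  · have hle : m ^ a ≤ m ^ b := Nat.le_of_dvd (Nat.pow_pos hm) ⟨N, by rw [← h, mul_comm]⟩
    obtain rfl : m = 1 := by
      by_contra hne
      exact absurd (Nat.pow_lt_pow_right (by omega : 1 < m) hab) (not_lt.mpr hle)
    simpa using h

theorem sum_sub_cyclic {A : Type} [AddCommGroup A] (n : ℕ) (g : Fin (n + 1) → A) :
    ∑ i, (g (i + 1) - g i) = 0 := by
  rw [Finset.sum_sub_distrib, sub_eq_zero]
  exact Equiv.sum_comp (Equiv.addRight (1 : Fin (n + 1))) g

theorem signed_coboundary (src tgt : E → V) (A : Type) [AddCommGroup A] (p : V → A)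
    (x : E × Bool) :
    (if x.2 then coboundary src tgt A p x.1 else -coboundary src tgt A p x.1) =
      p (uTgt src tgt x) - p (uSrc src tgt x) := by
  rcases x with ⟨e, _ | _⟩ <;> simp [coboundary_apply, uSrc, uTgt]

theorem isTension_coboundary (src tgt : E → V) (l : ℕ) (p : V → ZMod l) :
    IsTension src tgt l (coboundary src tgt (ZMod l) p) := by
  intro n c hc
  simp only [signed_coboundary, hc.2]
  exact sum_sub_cyclic n fun i => p (uSrc src tgt (c i))

/-- The simple graph underlying the spanning subgraph `(V, S)`. -/
def spanningGraph (src tgt : E → V) (S : Set E) : SimpleGraph V :=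
  SimpleGraph.fromRel (linkRel src tgt S)

theorem spanningGraph_reachable (src tgt : E → V) {S : Set E} {e : E} (he : e ∈ S) :
    (spanningGraph src tgt S).Reachable (src e) (tgt e) := by
  by_cases h : src e = tgt e
  · rw [h]
  · exact SimpleGraph.Adj.reachable
      ((SimpleGraph.fromRel_adj _ _ _).2 ⟨h, Or.inl ⟨e, he, rfl, rfl⟩⟩)

theorem exists_of_spanningGraph_adj (src tgt : E → V) {S : Set E} {u v : V}
    (h : (spanningGraph src tgt S).Adj u v) :
    ∃ x : E × Bool, x.1 ∈ S ∧ uSrc src tgt x = u ∧ uTgt src tgt x = v := by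
  rcases ((SimpleGraph.fromRel_adj _ _ _).1 h).2 with ⟨e, he, h₁, h₂⟩ | ⟨e, he, h₁, h₂⟩
  · exact ⟨(e, true), he, h₁, h₂⟩
  · exact ⟨(e, false), he, h₂, h₁⟩

/-- A tension that has a potential `p` on `S` also agrees with `p` on an edge closing a path
in `(V, S)`. -/
theorem IsTension.eq_coboundary_of_reachable {src tgt : E → V} {l : ℕ} {t : E → ZMod l}
    (ht : IsTension src tgt l t) {S : Set E} {p : V → ZMod l}
    (hp : ∀ e ∈ S, t e = coboundary src tgt (ZMod l) p e) {e : E}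
    (he : (spanningGraph src tgt S).Reachable (tgt e) (src e)) :
    t e = coboundary src tgt (ZMod l) p e := by
  obtain ⟨q, hq⟩ := he.exists_isPath
  have hstep : ∀ i : Fin q.length, ∃ x : E × Bool, x.1 ∈ S ∧
      uSrc src tgt x = q.getVert i ∧ uTgt src tgt x = q.getVert (i + 1) :=
    fun i => exists_of_spanningGraph_adj src tgt (q.adj_getVert_succ i.2)
  choose d hdS hdsrc hdtgt using hstep
  have hsrc : ∀ i, uSrc src tgt (Fin.snoc (α := fun _ => E × Bool) d (e, true) i) =
      q.getVert i := by
    intro i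
    induction i using Fin.lastCases with
    | last => simp [uSrc]
    | cast i => simp [hdsrc]
  have hcycle : IsUCycle src tgt q.length (Fin.snoc (α := fun _ => E × Bool) d (e, true)) := by
    refine ⟨fun i j hij => ?_, fun i => ?_⟩
    · simp only [hsrc] at hij
      exact Fin.ext (hq.getVert_injOn (Nat.lt_succ_iff.1 i.2) (Nat.lt_succ_iff.1 j.2) hij)
    · rw [hsrc]
      induction i using Fin.lastCases with
      | last => simp [uTgt]
      | cast i => simp [hdtgt]
  have hsum := ht _ _ hcycle
  have hd : ∀ i, (if (d i).2 then t (d i).1 else -t (d i).1) =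
      p (q.getVert (i + 1)) - p (q.getVert i) := by
    intro i
    rw [hp _ (hdS i), signed_coboundary, hdsrc, hdtgt]
  rw [Fin.sum_univ_castSucc] at hsum
  simp only [Fin.snoc_castSucc, Fin.snoc_last, hd, if_true] at hsum
  rw [Fin.sum_univ_eq_sum_range (fun i => p (q.getVert (i + 1)) - p (q.getVert i)),
    Finset.sum_range_sub (fun i => p (q.getVert i)), q.getVert_length, q.getVert_zero] at hsum
  rw [coboundary_apply, eq_neg_of_add_eq_zero_right hsum, neg_sub]

theorem IsTension.exists_potential [Finite E] {src tgt : E → V} {l : ℕ} {t : E → ZMod l}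
    (ht : IsTension src tgt l t) : ∃ p, coboundary src tgt (ZMod l) p = t := by
  suffices h : ∀ S : Set E, ∃ p, ∀ e ∈ S, t e = coboundary src tgt (ZMod l) p e by
    obtain ⟨p, hp⟩ := h Set.univ
    exact ⟨p, funext fun e => (hp e trivial).symm⟩
  intro S
  induction S, S.toFinite using Set.Finite.induction_on with
  | empty => exact ⟨0, by simp⟩
  | @insert e S _ _ ih =>
    obtain ⟨p, hp⟩ := ih
    by_cases he : (spanningGraph src tgt S).Reachable (tgt e) (src e)
    · refine ⟨p, fun x hx => ?_⟩
      rcases hx with rfl | hx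
      · exact ht.eq_coboundary_of_reachable hp he
      · exact hp x hx
    · refine ⟨fun w => p w + if (spanningGraph src tgt S).Reachable (tgt e) w then
        t e - (p (tgt e) - p (src e)) else 0, fun x hx => ?_⟩
      rcases hx with rfl | hx
      · simp only [coboundary_apply, SimpleGraph.Reachable.refl, he, if_true, if_false]
        abel
      · have hiff : (spanningGraph src tgt S).Reachable (tgt e) (tgt x) ↔
            (spanningGraph src tgt S).Reachable (tgt e) (src x) :=
          ⟨fun h => h.trans (spanningGraph_reachable src tgt hx).symm,
            fun h => h.trans (spanningGraph_reachable src tgt hx)⟩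
        rw [hp x hx]
        simp only [coboundary_apply, hiff]
        abel

theorem card_tension_vanishing_on [Fintype V] [Finite E] (src tgt : E → V) (l : ℕ) (hl : 0 < l)
    (S : Set E) :
    Nat.card {t : E → ZMod l // IsTension src tgt l t ∧ ∀ e ∈ S, t e = 0} =
      l ^ (rk src tgt Set.univ - rk src tgt S) := by
  have : NeZero l := ⟨hl.ne'⟩
  let φ := (coboundary src tgt (ZMod l)).comp (edgeConstant src tgt S (ZMod l)).subtype
  have hφ : ∀ (p : edgeConstant src tgt S (ZMod l)) e,
      φ p e = p.1 (tgt e) - p.1 (src e) := fun _ _ => rfl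
  have hrange : Nat.card {t : E → ZMod l // IsTension src tgt l t ∧ ∀ e ∈ S, t e = 0} =
      Nat.card φ.range := by
    refine Nat.card_congr (Equiv.subtypeEquivRight fun t => ⟨?_, ?_⟩)
    · rintro ⟨ht, hS⟩
      obtain ⟨p, rfl⟩ := ht.exists_potential
      exact ⟨⟨p, fun e he => (sub_eq_zero.1 (hS e he)).symm⟩, rfl⟩
    · rintro ⟨p, rfl⟩
      exact ⟨isTension_coboundary src tgt l p.1, fun e he => by rw [hφ, p.2 e he, sub_self]⟩
  have hker : Nat.card φ.ker = l ^ ncompSub src tgt Set.univ := by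
    rw [← card_edgeConstant]
    refine Nat.card_congr
      { toFun := fun p => ⟨p.1.1, fun e _ => (sub_eq_zero.1 (congrFun p.2 e)).symm⟩
        invFun := fun p => ⟨⟨p.1, fun e _ => p.2 e trivial⟩, ?_⟩
        left_inv := fun _ => rfl
        right_inv := fun _ => rfl }
    exact funext fun e => by rw [hφ, p.2 e trivial, sub_self]; rfl
  have hcard : Nat.card φ.range * l ^ ncompSub src tgt Set.univ = l ^ ncompSub src tgt S := by
    rw [← hker, ← card_edgeConstant, ← Nat.card_congr
      (QuotientAddGroup.quotientKerEquivRange φ).toEquiv]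
    exact (AddSubgroup.card_eq_card_quotient_mul_card_addSubgroup φ.ker).symm
  rw [hrange, eq_pow_sub_of_mul_pow_eq_pow hl hcard]
  have h₁ := ncompSub_le_card src tgt S
  have h₂ := ncompSub_le_card src tgt Set.univ
  congr 1
  unfold rk
  omega

/-- Orthogonality of characters on `ι → ZMod k`. -/
theorem sum_prod_stdAddChar {ι : Type} [Fintype ι] (k : ℕ) [NeZero k] (b : ι → ZMod k) :
    ∑ y : ι → ZMod k, ∏ i, ZMod.stdAddChar (y i * b i) =
      if b = 0 then (k : ℂ) ^ Fintype.card ι else 0 := by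
  have h := Finset.prod_univ_sum (fun _ : ι => (Finset.univ : Finset (ZMod k)))
    (fun i a => (ZMod.stdAddChar (a * b i) : ℂ))
  rw [Fintype.piFinset_univ] at h
  rw [← h]
  simp only [AddChar.sum_mulShift _ (ZMod.isPrimitive_stdAddChar k), ZMod.card]
  split_ifs with hb
  · simp [hb]
  · obtain ⟨i, hi⟩ := Function.ne_iff.1 hb
    exact Finset.prod_eq_zero (Finset.mem_univ i) (by simp_all)

/-- A bilinear pairing over `ZMod k`, written in two ways through coordinates, has left and right
kernels of complementary size. -/
theorem card_ker_mul_of_adjoint {ι κ : Type} [Fintype ι] [Fintype κ] (k : ℕ) [NeZero k]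
    (a : (κ → ZMod k) → ι → ZMod k) (b : (ι → ZMod k) → κ → ZMod k)
    (hab : ∀ x y, ∑ i, y i * a x i = ∑ j, x j * b y j) :
    Nat.card {x // a x = 0} * k ^ Fintype.card ι =
      Nat.card {y // b y = 0} * k ^ Fintype.card κ := by
  have key : ∀ x y, ∏ i, (ZMod.stdAddChar (y i * a x i) : ℂ) =
      ∏ j, ZMod.stdAddChar (x j * b y j) := by
    intro x y
    have hsum : ∀ {α : Type} [Fintype α] (g : α → ZMod k),
        ∏ i, (ZMod.stdAddChar (g i) : ℂ) = ZMod.stdAddChar (∑ i, g i) := fun g =>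
      (map_prod (ZMod.stdAddChar (N := k)).toMonoidHom (fun i => Multiplicative.ofAdd (g i))
        Finset.univ).symm
    rw [hsum, hsum, hab]
  have h := Finset.sum_comm (s := Finset.univ) (t := Finset.univ)
    (f := fun (x : κ → ZMod k) (y : ι → ZMod k) => ∏ i, (ZMod.stdAddChar (y i * a x i) : ℂ))
  simp only [sum_prod_stdAddChar] at h
  simp only [key, sum_prod_stdAddChar, ← Finset.sum_filter, Finset.sum_const, nsmul_eq_mul] at h
  rw [Nat.card_eq_fintype_card, Nat.card_eq_fintype_card, Fintype.card_subtype,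
    Fintype.card_subtype]
  exact_mod_cast h

theorem card_isFlow [Fintype V] [Fintype E] (src tgt : E → V) (k : ℕ) [NeZero k] :
    Nat.card {f : E → ZMod k // IsFlow src tgt k f} * k ^ Fintype.card V =
      k ^ (Fintype.card E + ncompSub src tgt Set.univ) := by
  have h := card_ker_mul_of_adjoint k
    (fun (f : E → ZMod k) (v : V) =>
      (∑ e, if tgt e = v then f e else 0) - ∑ e, if src e = v then f e else 0)
    (fun p => coboundary src tgt (ZMod k) p) (by
      intro f p
      simp only [mul_sub, Finset.sum_sub_distrib, Finset.mul_sum, coboundary_apply]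
      rw [Finset.sum_comm, Finset.sum_comm (s := Finset.univ (α := V))]
      simp [mul_comm])
  have hflow : Nat.card {f : E → ZMod k // IsFlow src tgt k f} = Nat.card {f : E → ZMod k //
      (fun v : V => (∑ e, if tgt e = v then f e else 0) -
        ∑ e, if src e = v then f e else 0) = 0} :=
    Nat.card_congr (Equiv.subtypeEquivRight fun f => by
      simp [IsFlow, funext_iff, sub_eq_zero])
  have hconst : Nat.card {p : V → ZMod k // coboundary src tgt (ZMod k) p = 0} =
      k ^ ncompSub src tgt Set.univ := by
    rw [← card_edgeConstant]
    exact Nat.card_congr (Equiv.subtypeEquivRight fun p =>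
      ⟨fun h e _ => (sub_eq_zero.1 (congrFun h e)).symm,
        fun h => funext fun e => sub_eq_zero.2 (h e trivial).symm⟩)
  rw [hflow, h, hconst, pow_add, mul_comm]

theorem ncompSub_restrict (src tgt : E → V) (S : Set E) :
    ncompSub (fun e : S => src e) (fun e : S => tgt e) Set.univ = ncompSub src tgt S := by
  have : linkRel (fun e : S => src e) (fun e : S => tgt e) Set.univ = linkRel src tgt S := by
    ext u v
    simp [linkRel, and_left_comm]
  rw [ncompSub, this, ncompSub]

theorem isFlow_extend_iff [Fintype E] (src tgt : E → V) (k : ℕ) (S : Finset E)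
    (f : E → ZMod k) (hf : ∀ e ∉ S, f e = 0) :
    IsFlow (fun e : S => src e) (fun e : S => tgt e) k (fun e : S => f e) ↔
      IsFlow src tgt k f := by
  have hsum : ∀ (g : E → V) (v : V), (∑ e : S, if g e = v then f e else 0) =
      ∑ e, if g e = v then f e else 0 := by
    intro g v
    rw [Finset.sum_coe_sort S (fun e => if g e = v then f e else 0)]
    exact Finset.sum_subset (Finset.subset_univ S) fun e _ he => by simp [hf e he]
  simp only [IsFlow, hsum src, hsum tgt]

theorem card_flow_supported_on [Fintype V] [Fintype E] (src tgt : E → V) (k : ℕ) (hk : 0 < k)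
    (S : Finset E) :
    Nat.card {f : E → ZMod k // IsFlow src tgt k f ∧ ∀ e ∉ S, f e = 0} =
      k ^ (S.card - rk src tgt ↑S) := by
  have : NeZero k := ⟨hk.ne'⟩
  have hrestrict : Nat.card {f : E → ZMod k // IsFlow src tgt k f ∧ ∀ e ∉ S, f e = 0} =
      Nat.card {f : S → ZMod k // IsFlow (fun e : S => src e) (fun e : S => tgt e) k f} := by
    refine Nat.card_congr
      { toFun := fun f => ⟨fun e => f.1 e, (isFlow_extend_iff src tgt k S f.1 f.2.2).2 f.2.1⟩
        invFun := fun f => ⟨fun e => if h : e ∈ S then f.1 ⟨e, h⟩ else 0, ?_, ?_⟩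
        left_inv := fun f => ?_
        right_inv := fun f => ?_ }
    · refine (isFlow_extend_iff src tgt k S _ fun e he => dif_neg he).1 ?_
      simpa using f.2
    · exact fun e he => dif_neg he
    · ext e
      by_cases h : e ∈ S
      · simp [h]
      · simp [h, f.2.2 e h]
    · ext e
      simp
  have h := card_isFlow (fun e : S => src e) (fun e : S => tgt e) k
  have hn : ncompSub (fun e : S => src e) (fun e : S => tgt e) Set.univ =
      ncompSub src tgt (S : Set E) := ncompSub_restrict src tgt (S : Set E)
  rw [hn, Fintype.card_coe] at h
  rw [hrestrict, eq_pow_sub_of_mul_pow_eq_pow hk h]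
  have hle := ncompSub_le_card src tgt (S : Set E)
  congr 1
  unfold rk
  omega

theorem sigma_subtype_prod_ext {α β γ : Type} {P : α → β → Prop} {Q : α → γ → Prop}
    {x y : (a : α) × ({b // P a b} × {c // Q a c})} (h₁ : x.1 = y.1)
    (h₂ : x.2.1.1 = y.2.1.1) (h₃ : x.2.2.1 = y.2.2.1) : x = y := by
  obtain ⟨a, ⟨b, hb⟩, ⟨c, hc⟩⟩ := x
  obtain ⟨a', ⟨b', hb'⟩, ⟨c', hc'⟩⟩ := y
  dsimp only at h₁ h₂ h₃
  subst h₁ h₂ h₃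
  rfl

/-- Triples `(f, t, σ)` as in `tutte_interpretation` correspond to the edge set
`S = supp f ∪ σ`, a flow supported on `S` and a tension vanishing on `S`. -/
noncomputable def tripleEquiv [Fintype E] (src tgt : E → V) (k l : ℕ) :
    {p : (E → ZMod k) × (E → ZMod l) × Set E //
        IsFlow src tgt k p.1 ∧ IsTension src tgt l p.2.1 ∧
        {e | p.1 e ≠ 0} ∩ {e | p.2.1 e ≠ 0} = ∅ ∧
        p.2.2 ⊆ {e | p.1 e = 0} ∩ {e | p.2.1 e = 0}} ≃
      (S : Finset E) × ({f : E → ZMod k // IsFlow src tgt k f ∧ ∀ e ∉ S, f e = 0} ×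
        {t : E → ZMod l // IsTension src tgt l t ∧ ∀ e ∈ (S : Set E), t e = 0}) where
  toFun p := ⟨({e | p.1.1 e ≠ 0} ∪ p.1.2.2).toFinset,
    ⟨p.1.1, p.2.1, fun e he => by
      by_contra h
      exact he (by simp [h])⟩,
    ⟨p.1.2.1, p.2.2.1, fun e he => by
      rcases (by simpa using he : p.1.1 e ≠ 0 ∨ e ∈ p.1.2.2) with h | h
      · by_contra h'
        exact (p.2.2.2.1.subset ⟨h, h'⟩ : e ∈ (∅ : Set E))
      · exact (p.2.2.2.2 h).2⟩⟩
  invFun q := ⟨(q.2.1.1, q.2.2.1, {e | e ∈ q.1 ∧ q.2.1.1 e = 0}), q.2.1.2.1, q.2.2.2.1,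
    Set.eq_empty_of_forall_notMem fun e he => by
      by_cases h : e ∈ q.1
      · exact he.2 (q.2.2.2.2 e h)
      · exact he.1 (q.2.1.2.2 e h),
    fun e he => ⟨he.2, q.2.2.2.2 e he.1⟩⟩
  left_inv p := by
    refine Subtype.ext (Prod.ext rfl (Prod.ext rfl (Set.ext fun e => ?_)))
    have h : e ∈ p.1.2.2 → p.1.1 e = 0 := fun he => (p.2.2.2.2 he).1
    simp only [Set.mem_ofPred_eq, Set.mem_toFinset, Set.mem_union]
    tauto
  right_inv q := by
    refine sigma_subtype_prod_ext (Finset.ext fun e => ?_) rfl rfl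
    have h := q.2.1.2.2 e
    simp only [Set.mem_ofPred_eq, Set.mem_toFinset, Set.mem_union]
    tauto

/-- **Interpretation of the Tutte polynomial.** `t_G(1+ℓ, 1+k)` counts the
triples `(f, t, σ)` of a `ZMod k`-flow `f`, a `ZMod ℓ`-tension `t` with
`supp f ∩ supp t = ∅`, and a set `σ ⊆ E ∖ (supp f ∪ supp t)`. -/
theorem tutte_interpretation {V E : Type} [Fintype V] [Fintype E]
    (src tgt : E → V) (k l : ℕ) (hk : 0 < k) (hl : 0 < l) :
    tutte src tgt (1 + (l : ℚ)) (1 + (k : ℚ)) =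
      Nat.card {p : (E → ZMod k) × (E → ZMod l) × Set E //
        IsFlow src tgt k p.1 ∧ IsTension src tgt l p.2.1 ∧
        {e | p.1 e ≠ 0} ∩ {e | p.2.1 e ≠ 0} = ∅ ∧
        p.2.2 ⊆ {e | p.1 e = 0} ∩ {e | p.2.1 e = 0}} := by
  have : NeZero k := ⟨hk.ne'⟩
  have : NeZero l := ⟨hl.ne'⟩
  rw [Nat.card_congr (tripleEquiv src tgt k l), Nat.card_sigma, Nat.cast_sum]
  refine Finset.sum_congr rfl fun S _ => ?_
  rw [Nat.card_prod, card_flow_supported_on src tgt k hk S,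
    card_tension_vanishing_on src tgt l hl (S : Set E)]
  push_cast
  ring

end ModularFlows
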